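/- For n ≥ 2 and 1 ≤ i ≤ n−1, the following equalities hold in Br(B_n): (i) e_i·e_i* = e_i·e_{i−1}·⋯·e_1·e_0·e_1·⋯·e_{i−1}·e_i; (ii) r_0·e_i·e_i* = e_i·e_i*. -/

import Mathlib

/-- The ground ring `ℤ[δ, δ⁻¹]` of Laurent polynomials over `ℤ`. -/
abbrev Lp : Type := LaurentPolynomial ℤ

/-- The parameter `δ`. -/
noncomputable def δpar : Lp := LaurentPolynomial.T 1

/-- Generators of the Brauer algebra of type `B_n`: `r i` and `e i` for `0 ≤ i ≤ n-1`. -/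
inductive BGen (n : ℕ) : Type
  | r (i : Fin n) : BGen n
  | e (i : Fin n) : BGen n

/-- The generator `r i` viewed in the free algebra. -/
noncomputable def fr {n : ℕ} (i : Fin n) : FreeAlgebra Lp (BGen n) :=
  FreeAlgebra.ι Lp (BGen.r i)

/-- The generator `e i` viewed in the free algebra. -/
noncomputable def fe {n : ℕ} (i : Fin n) : FreeAlgebra Lp (BGen n) :=
  FreeAlgebra.ι Lp (BGen.e i)

/-- The defining relations of the Brauer algebra of type `B_n`. -/
inductive BrauerBRel (n : ℕ) : FreeAlgebra Lp (BGen n) → FreeAlgebra Lp (BGen n) → Prop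
  | rr (i : Fin n) : BrauerBRel n (fr i * fr i) 1
  | re (i : Fin n) : BrauerBRel n (fr i * fe i) (fe i)
  | er (i : Fin n) : BrauerBRel n (fe i * fr i) (fe i)
  | ee (i : Fin n) (h : 0 < i.val) : BrauerBRel n (fe i * fe i) (δpar • fe i)
  | e0e0 (i : Fin n) (h : i.val = 0) : BrauerBRel n (fe i * fe i) ((δpar * δpar) • fe i)
  | rrFar (i j : Fin n) (h : i.val + 2 ≤ j.val ∨ j.val + 2 ≤ i.val) :
      BrauerBRel n (fr i * fr j) (fr j * fr i)
  | erFar (i j : Fin n) (h : i.val + 2 ≤ j.val ∨ j.val + 2 ≤ i.val) :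
      BrauerBRel n (fe i * fr j) (fr j * fe i)
  | eeFar (i j : Fin n) (h : i.val + 2 ≤ j.val ∨ j.val + 2 ≤ i.val) :
      BrauerBRel n (fe i * fe j) (fe j * fe i)
  | braid (i j : Fin n) (h : i.val + 1 = j.val ∨ j.val + 1 = i.val)
      (hi : 0 < i.val) (hj : 0 < j.val) :
      BrauerBRel n (fr i * fr j * fr i) (fr j * fr i * fr j)
  | rre (i j : Fin n) (h : i.val + 1 = j.val ∨ j.val + 1 = i.val)
      (hi : 0 < i.val) (hj : 0 < j.val) :
      BrauerBRel n (fr j * fr i * fe j) (fe i * fe j)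
  | rer (i j : Fin n) (h : i.val + 1 = j.val ∨ j.val + 1 = i.val)
      (hi : 0 < i.val) (hj : 0 < j.val) :
      BrauerBRel n (fr i * fe j * fr i) (fr j * fe i * fr j)
  | b1010 (i j : Fin n) (h0 : i.val = 0) (h1 : j.val = 1) :
      BrauerBRel n (fr j * fr i * fr j * fr i) (fr i * fr j * fr i * fr j)
  | b_r0r1e0 (i j : Fin n) (h0 : i.val = 0) (h1 : j.val = 1) :
      BrauerBRel n (fr i * fr j * fe i) (fr j * fe i)
  | b_r0e1r0e1 (i j : Fin n) (h0 : i.val = 0) (h1 : j.val = 1) :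
      BrauerBRel n (fr i * fe j * fr i * fe j) (fe j * fe i * fe j)
  | b_r0r1r0e1 (i j : Fin n) (h0 : i.val = 0) (h1 : j.val = 1) :
      BrauerBRel n (fr i * fr j * fr i * fe j) (fe j * (fr i * fr j * fr i))
  | b_e0r1e0 (i j : Fin n) (h0 : i.val = 0) (h1 : j.val = 1) :
      BrauerBRel n (fe i * fr j * fe i) (δpar • fe i)
  | b_e0e1e0 (i j : Fin n) (h0 : i.val = 0) (h1 : j.val = 1) :
      BrauerBRel n (fe i * fe j * fe i) (δpar • fe i)
  | b_e0r1r0 (i j : Fin n) (h0 : i.val = 0) (h1 : j.val = 1) :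
      BrauerBRel n (fe i * fr j * fr i) (fe i * fr j)
  | b_e0e1r0 (i j : Fin n) (h0 : i.val = 0) (h1 : j.val = 1) :
      BrauerBRel n (fe i * fe j * fr i) (fe i * fe j)

/-- The Brauer algebra of type `B_n` over `ℤ[δ, δ⁻¹]`. -/
abbrev BrauerB (n : ℕ) : Type := RingQuot (BrauerBRel n)

/-- The generator `r i` of `Br(B_n)` (defined to be `1` for out-of-range indices). -/
noncomputable def rb (n : ℕ) (i : ℕ) : BrauerB n :=
  if h : i < n then RingQuot.mkAlgHom Lp (BrauerBRel n) (fr ⟨i, h⟩) else 1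

/-- The generator `e i` of `Br(B_n)` (defined to be `1` for out-of-range indices). -/
noncomputable def eb (n : ℕ) (i : ℕ) : BrauerB n :=
  if h : i < n then RingQuot.mkAlgHom Lp (BrauerBRel n) (fe ⟨i, h⟩) else 1


/-- The elements `e_i*` of `Br(B_n)`: `e₁* = r₀e₁r₀` and
`e_i* = r_{i-1}r_i·e_{i-1}*·r_ir_{i-1}` for `i ≥ 2` (junk value `1` at `i = 0`). -/
noncomputable def es (n : ℕ) : ℕ → BrauerB n
  | 0 => 1
  | 1 => rb n 0 * eb n 1 * rb n 0
  | (i + 2) => rb n (i + 1) * rb n (i + 2) * es n (i + 1) * rb n (i + 2) * rb n (i + 1)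

/-- The descending chain `e_i e_{i-1} ⋯ e_1 e_0` in `Br(B_n)`. -/
noncomputable def downChain (n : ℕ) : ℕ → BrauerB n
  | 0 => eb n 0
  | (k + 1) => eb n (k + 1) * downChain n k

/-- The ascending chain `e_1 e_2 ⋯ e_i` in `Br(B_n)` (equal to `1` for `i = 0`). -/
noncomputable def upChain (n : ℕ) : ℕ → BrauerB n
  | 0 => 1
  | (k + 1) => upChain n k * eb n (k + 1)

theorem rb_eq {n i : ℕ} (h : i < n) :
    rb n i = RingQuot.mkAlgHom Lp (BrauerBRel n) (fr ⟨i, h⟩) := dif_pos h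

theorem eb_eq {n i : ℕ} (h : i < n) :
    eb n i = RingQuot.mkAlgHom Lp (BrauerBRel n) (fe ⟨i, h⟩) := dif_pos h

theorem rb_mul_self {n i : ℕ} (h : i < n) : rb n i * rb n i = 1 := by
  simpa only [rb_eq h, map_mul, map_one] using
    RingQuot.mkAlgHom_rel Lp (BrauerBRel.rr (⟨i, h⟩ : Fin n))

theorem eb_mul_self {n i : ℕ} (h : i < n) (hi : 0 < i) : eb n i * eb n i = δpar • eb n i := by
  simpa only [eb_eq h, map_mul, map_smul] using
    RingQuot.mkAlgHom_rel Lp (BrauerBRel.ee (⟨i, h⟩ : Fin n) hi)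

theorem eb_mul_rb_zero {n i : ℕ} (h : i < n) (hi : 2 ≤ i) :
    eb n i * rb n 0 = rb n 0 * eb n i := by
  have h0 : 0 < n := by omega
  simpa only [eb_eq h, rb_eq h0, map_mul] using
    RingQuot.mkAlgHom_rel Lp
      (BrauerBRel.erFar (⟨i, h⟩ : Fin n) ⟨0, h0⟩ (Or.inr (by simpa using hi)))

theorem rb_mul_rb_mul_eb {n i j : ℕ} (hi : i < n) (hj : j < n)
    (hij : i + 1 = j ∨ j + 1 = i) (hi0 : 0 < i) (hj0 : 0 < j) :
    rb n j * rb n i * eb n j = eb n i * eb n j := by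
  simpa only [eb_eq hi, eb_eq hj, rb_eq hi, rb_eq hj, map_mul] using
    RingQuot.mkAlgHom_rel Lp (BrauerBRel.rre (⟨i, hi⟩ : Fin n) ⟨j, hj⟩ hij hi0 hj0)

theorem rb_mul_eb_mul_rb {n i j : ℕ} (hi : i < n) (hj : j < n)
    (hij : i + 1 = j ∨ j + 1 = i) (hi0 : 0 < i) (hj0 : 0 < j) :
    rb n i * eb n j * rb n i = rb n j * eb n i * rb n j := by
  simpa only [eb_eq hi, eb_eq hj, rb_eq hi, rb_eq hj, map_mul] using
    RingQuot.mkAlgHom_rel Lp (BrauerBRel.rer (⟨i, hi⟩ : Fin n) ⟨j, hj⟩ hij hi0 hj0)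

/-- The relation `e_j r_i r_j = e_j e_i`, opposite to the defining `r_j r_i e_j = e_i e_j`. -/
theorem eb_mul_rb_mul_rb {n i j : ℕ} (hi : i < n) (hj : j < n)
    (hij : i + 1 = j ∨ j + 1 = i) (hi0 : 0 < i) (hj0 : 0 < j) :
    eb n j * rb n i * rb n j = eb n j * eb n i := by
  calc eb n j * rb n i * rb n j
      = (rb n i * rb n i) * eb n j * rb n i * rb n j := by rw [rb_mul_self hi, one_mul]
    _ = rb n i * (rb n i * eb n j * rb n i) * rb n j := by simp only [mul_assoc]
    _ = rb n i * rb n j * eb n i * (rb n j * rb n j) := by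
        rw [rb_mul_eb_mul_rb hi hj hij hi0 hj0]; simp only [mul_assoc]
    _ = eb n j * eb n i := by
        rw [rb_mul_self hj, mul_one, rb_mul_rb_mul_eb hj hi hij.symm hj0 hi0]

theorem rb_zero_eb_one_rb_zero_eb_one {n : ℕ} (hn : 2 ≤ n) :
    rb n 0 * eb n 1 * rb n 0 * eb n 1 = eb n 1 * eb n 0 * eb n 1 := by
  have h0 : 0 < n := by omega
  have h1 : 1 < n := hn
  simpa only [eb_eq h0, eb_eq h1, rb_eq h0, map_mul] using
    RingQuot.mkAlgHom_rel Lp (BrauerBRel.b_r0e1r0e1 (⟨0, h0⟩ : Fin n) ⟨1, h1⟩ rfl rfl)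

theorem eb_zero_eb_one_rb_zero {n : ℕ} (hn : 2 ≤ n) :
    eb n 0 * eb n 1 * rb n 0 = eb n 0 * eb n 1 := by
  have h0 : 0 < n := by omega
  have h1 : 1 < n := hn
  simpa only [eb_eq h0, eb_eq h1, rb_eq h0, map_mul] using
    RingQuot.mkAlgHom_rel Lp (BrauerBRel.b_e0e1r0 (⟨0, h0⟩ : Fin n) ⟨1, h1⟩ rfl rfl)

theorem δpar_smul_injective (n : ℕ) : Function.Injective (fun x : BrauerB n => δpar • x) := by
  intro x y hxy
  have h : (LaurentPolynomial.T (-1) : Lp) * δpar = 1 := by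
    rw [δpar, ← LaurentPolynomial.T_add]
    simp
  simpa only [smul_smul, h, one_smul] using
    congrArg (fun z : BrauerB n => (LaurentPolynomial.T (-1) : Lp) • z) hxy

theorem eb_one_rb_zero_eb_one_eq_rb_zero_mul {n : ℕ} (hn : 2 ≤ n) :
    eb n 1 * rb n 0 * eb n 1 = rb n 0 * (eb n 1 * eb n 0 * eb n 1) := by
  rw [← rb_zero_eb_one_rb_zero_eb_one hn]
  simp only [← mul_assoc]
  rw [rb_mul_self (by omega), one_mul]

theorem eb_one_rb_zero_eb_one_rb_zero {n : ℕ} (hn : 2 ≤ n) :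
    eb n 1 * rb n 0 * eb n 1 * rb n 0 = eb n 1 * rb n 0 * eb n 1 := by
  rw [eb_one_rb_zero_eb_one_eq_rb_zero_mul hn]
  simp only [mul_assoc]
  rw [← mul_assoc (eb n 0), eb_zero_eb_one_rb_zero hn]

theorem eb_one_rb_zero_eb_one {n : ℕ} (hn : 2 ≤ n) :
    eb n 1 * rb n 0 * eb n 1 = eb n 1 * eb n 0 * eb n 1 := by
  have he := eb_mul_self (n := n) (i := 1) hn one_pos
  apply δpar_smul_injective n
  calc δpar • (eb n 1 * rb n 0 * eb n 1)
      = eb n 1 * rb n 0 * eb n 1 * rb n 0 * eb n 1 := by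
        rw [eb_one_rb_zero_eb_one_rb_zero hn, mul_assoc _ (eb n 1) (eb n 1), he,
          mul_smul_comm]
    _ = eb n 1 * (rb n 0 * eb n 1 * rb n 0 * eb n 1) := by simp only [mul_assoc]
    _ = δpar • (eb n 1 * eb n 0 * eb n 1) := by
        rw [rb_zero_eb_one_rb_zero_eb_one hn]
        simp only [← mul_assoc]
        rw [he, smul_mul_assoc, smul_mul_assoc]

theorem eb_mul_es_succ {n k : ℕ} (h : k + 2 < n) :
    eb n (k + 2) * es n (k + 2) =
      eb n (k + 2) * (eb n (k + 1) * es n (k + 1)) * rb n (k + 2) * rb n (k + 1) := by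
  have h' : k + 1 < n := by omega
  rw [es]
  simp only [← mul_assoc]
  rw [eb_mul_rb_mul_rb h' h (Or.inl rfl) (by omega) (by omega)]

/-- For `n ≥ 2` and `1 ≤ i ≤ n-1`, in `Br(B_n)`:
(i) `e_i·e_i* = e_i·e_{i-1}⋯e_1·e_0·e_1⋯e_{i-1}·e_i`; (ii) `r₀·e_i·e_i* = e_i·e_i*`. -/
theorem statement_8 (n : ℕ) (hn : 2 ≤ n) (i : ℕ) (h1 : 1 ≤ i) (h2 : i ≤ n - 1) :
    eb n i * es n i = downChain n i * upChain n i ∧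
    rb n 0 * (eb n i * es n i) = eb n i * es n i := by
  induction i, h1 using Nat.le_induction with
  | base =>
    have h : eb n 1 * es n 1 = eb n 1 * eb n 0 * eb n 1 := by
      rw [es, ← eb_one_rb_zero_eb_one hn, ← eb_one_rb_zero_eb_one_rb_zero hn]
      simp only [mul_assoc]
    refine ⟨by simp [h, downChain, upChain], ?_⟩
    rw [h, ← eb_one_rb_zero_eb_one_eq_rb_zero_mul hn, eb_one_rb_zero_eb_one hn]
  | succ m hm ih =>
    obtain ⟨k, rfl⟩ := Nat.exists_eq_add_of_le' hm
    obtain ⟨ih1, ih2⟩ := ih (by omega)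
    have hk : k + 2 < n := by omega
    rw [eb_mul_es_succ hk]
    constructor
    · rw [ih1]
      simp only [downChain, upChain, mul_assoc]
      rw [← mul_assoc (eb n (k + 1)) (rb n (k + 1 + 1)),
        eb_mul_rb_mul_rb hk (by omega) (Or.inr rfl) (by omega) (by omega)]
    · rw [← mul_assoc, ← mul_assoc, ← mul_assoc, ← eb_mul_rb_zero hk (by omega),
        mul_assoc (eb n (k + 2)), ih2]
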